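/- arXiv:2406.07241 — 5 statements merged into one kernel-verified Lean document; each statement's English description precedes it below -/
import Mathlib

section
/- Let 𝔤 be a Lie algebra over a commutative ring, J : 𝔤 → 𝔤 a linear map, and let T𝔤 = 𝔤 × 𝔤 be the tangent Lie algebra with complete lift X^c := (X,0) and vertical lift X^v := (0,X). Define Ĵ : T𝔤 → T𝔤 by Ĵ(X^c) = (JX)^c and Ĵ(X^v) = (JX)^v. Then for all X, Y ∈ 𝔤: N_Ĵ(X^v, Y^v) = 0, N_Ĵ(X^c, Y^c) = (N_J(X,Y))^c, and N_Ĵ(X^c, Y^v) = (N_J(X,Y))^v. -/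
/-- The tangent Lie ring structure on `L × L`:
`⁅(X₁,X₂),(Y₁,Y₂)⁆ = (⁅X₁,Y₁⁆, ⁅X₁,Y₂⁆ + ⁅X₂,Y₁⁆)`. -/
instance tangentLieRing (L : Type*) [LieRing L] : LieRing (L × L) where
  bracket x y := (⁅x.1, y.1⁆, ⁅x.1, y.2⁆ + ⁅x.2, y.1⁆)
  add_lie x y z := by
    show (⁅x.1 + y.1, z.1⁆, ⁅x.1 + y.1, z.2⁆ + ⁅x.2 + y.2, z.1⁆)
        = (⁅x.1, z.1⁆ + ⁅y.1, z.1⁆, (⁅x.1, z.2⁆ + ⁅x.2, z.1⁆) + (⁅y.1, z.2⁆ + ⁅y.2, z.1⁆))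
    refine Prod.ext ?_ ?_ <;> simp only [add_lie] <;> abel
  lie_add x y z := by
    show (⁅x.1, y.1 + z.1⁆, ⁅x.1, y.2 + z.2⁆ + ⁅x.2, y.1 + z.1⁆)
        = (⁅x.1, y.1⁆ + ⁅x.1, z.1⁆, (⁅x.1, y.2⁆ + ⁅x.2, y.1⁆) + (⁅x.1, z.2⁆ + ⁅x.2, z.1⁆))
    refine Prod.ext ?_ ?_ <;> simp only [lie_add] <;> abel
  lie_self x := by
    show (⁅x.1, x.1⁆, ⁅x.1, x.2⁆ + ⁅x.2, x.1⁆) = (0, 0)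
    refine Prod.ext ?_ ?_
    · exact lie_self x.1
    · rw [← lie_skew x.1 x.2]; abel
  leibniz_lie x y z := by
    show (⁅x.1, ⁅y.1, z.1⁆⁆, ⁅x.1, ⁅y.1, z.2⁆ + ⁅y.2, z.1⁆⁆ + ⁅x.2, ⁅y.1, z.1⁆⁆)
        = (⁅⁅x.1, y.1⁆, z.1⁆ + ⁅y.1, ⁅x.1, z.1⁆⁆,
           (⁅⁅x.1, y.1⁆, z.2⁆ + ⁅⁅x.1, y.2⁆ + ⁅x.2, y.1⁆, z.1⁆)
             + (⁅y.1, ⁅x.1, z.2⁆ + ⁅x.2, z.1⁆⁆ + ⁅y.2, ⁅x.1, z.1⁆⁆))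
    refine Prod.ext ?_ ?_
    · exact leibniz_lie x.1 y.1 z.1
    · rw [lie_add x.1, lie_add y.1, add_lie, leibniz_lie x.1 y.1 z.2,
        leibniz_lie x.1 y.2 z.1, leibniz_lie x.2 y.1 z.1]
      abel

/-- The tangent Lie algebra structure on `L × L`. -/
instance tangentLieAlgebra (R : Type*) (L : Type*) [CommRing R] [LieRing L] [LieAlgebra R L] :
    LieAlgebra R (L × L) where
  lie_smul t x y := by
    show (⁅x.1, t • y.1⁆, ⁅x.1, t • y.2⁆ + ⁅x.2, t • y.1⁆)
        = (t • ⁅x.1, y.1⁆, t • (⁅x.1, y.2⁆ + ⁅x.2, y.1⁆))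
    refine Prod.ext ?_ ?_
    · exact lie_smul t x.1 y.1
    · show ⁅x.1, t • y.2⁆ + ⁅x.2, t • y.1⁆ = t • (⁅x.1, y.2⁆ + ⁅x.2, y.1⁆)
      rw [lie_smul, lie_smul, smul_add]

/-- The Nijenhuis tensor of a linear map `J : L → L` on a Lie algebra `L`. -/
def nijenhuis {R L : Type*} [CommRing R] [LieRing L] [LieAlgebra R L]
    (J : L →ₗ[R] L) (X Y : L) : L :=
  J ⁅J X, Y⁆ + J ⁅X, J Y⁆ + ⁅X, Y⁆ - ⁅J X, J Y⁆


section TangentBracket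

variable {L : Type*} [LieRing L]

theorem tangent_lie_complete_complete (X Y : L) :
    ⁅((X, 0) : L × L), ((Y, 0) : L × L)⁆ = (⁅X, Y⁆, 0) := by
  change ((⁅X, Y⁆, ⁅X, (0 : L)⁆ + ⁅(0 : L), Y⁆) : L × L) = _
  rw [lie_zero, zero_lie, add_zero]

theorem tangent_lie_complete_vertical (X Y : L) :
    ⁅((X, 0) : L × L), ((0, Y) : L × L)⁆ = (0, ⁅X, Y⁆) := by
  change ((⁅X, (0 : L)⁆, ⁅X, Y⁆ + ⁅(0 : L), (0 : L)⁆) : L × L) = _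
  rw [lie_zero, lie_zero, add_zero]

theorem tangent_lie_vertical_vertical (X Y : L) :
    ⁅((0, X) : L × L), ((0, Y) : L × L)⁆ = 0 := by
  change ((⁅(0 : L), (0 : L)⁆, ⁅(0 : L), Y⁆ + ⁅X, (0 : L)⁆) : L × L) = _
  rw [lie_zero, lie_zero, zero_lie, add_zero]
  rfl

end TangentBracket

/-- With complete lift `X^c = (X,0)` and vertical lift `X^v = (0,X)` in the
tangent Lie algebra `T𝔤 = 𝔤 × 𝔤`, and `Ĵ` defined by `Ĵ X^c = (J X)^c`, `Ĵ X^v = (J X)^v`,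
one has `N_Ĵ(X^v,Y^v) = 0`, `N_Ĵ(X^c,Y^c) = (N_J(X,Y))^c` and `N_Ĵ(X^c,Y^v) = (N_J(X,Y))^v`. -/
theorem nijenhuis_tangent_lift_on_lifts
    {R L : Type*} [CommRing R] [LieRing L] [LieAlgebra R L]
    (J : L →ₗ[R] L) (Jhat : L × L →ₗ[R] L × L)
    (hc : ∀ X : L, Jhat (X, 0) = (J X, 0))
    (hv : ∀ X : L, Jhat (0, X) = (0, J X)) :
    (∀ X Y : L, nijenhuis Jhat (0, X) (0, Y) = 0) ∧
    (∀ X Y : L, nijenhuis Jhat (X, 0) (Y, 0) = (nijenhuis J X Y, 0)) ∧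
    (∀ X Y : L, nijenhuis Jhat (X, 0) (0, Y) = (0, nijenhuis J X Y)) := by
  refine ⟨fun X Y => ?_, fun X Y => ?_, fun X Y => ?_⟩
  · simp only [nijenhuis, hv, tangent_lie_vertical_vertical, map_zero, add_zero, sub_zero]
  · simp only [nijenhuis, hc, tangent_lie_complete_complete]
    refine Prod.ext rfl ?_
    change (0 : L) + 0 + 0 - 0 = 0
    simp
  · simp only [nijenhuis, hc, hv, tangent_lie_complete_vertical]
    refine Prod.ext ?_ rfl
    change (0 : L) + 0 + 0 - 0 = 0
    simp
end

section
/- Let 𝔤 be a Lie algebra over a commutative ring and let J : 𝔤 → 𝔤 be an integrable almost complex structure, i.e., J² = −id and the Nijenhuis tensor N_J vanishes identically. Then the linear map Ĵ : T𝔤 → T𝔤 on the tangent Lie algebra T𝔤 = 𝔤 × 𝔤 defined by Ĵ(X₁,X₂) := (JX₁, JX₂) satisfies Ĵ² = −id and N_Ĵ = 0; that is, Ĵ is an integrable almost complex structure on T𝔤. -/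
@[simp]
theorem tangent_lie_def {L : Type*} [LieRing L] (p q : L × L) :
    ⁅p, q⁆ = (⁅p.1, q.1⁆, ⁅p.1, q.2⁆ + ⁅p.2, q.1⁆) := rfl

/-- If `J` is an integrable almost complex structure on a Lie algebra `𝔤`
(`J² = -id` and `N_J ≡ 0`), then `Ĵ (X₁,X₂) = (J X₁, J X₂)` is an integrable almost complex
structure on the tangent Lie algebra `T𝔤 = 𝔤 × 𝔤`. -/
theorem tangent_lift_integrable
    {R L : Type*} [CommRing R] [LieRing L] [LieAlgebra R L]
    (J : L →ₗ[R] L) (hJ2 : ∀ X : L, J (J X) = -X)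
    (hNJ : ∀ X Y : L, nijenhuis J X Y = 0)
    (Jhat : L × L →ₗ[R] L × L)
    (hJhat : ∀ p : L × L, Jhat p = (J p.1, J p.2)) :
    (∀ p : L × L, Jhat (Jhat p) = -p) ∧
    (∀ p q : L × L, nijenhuis Jhat p q = 0) := by
  refine ⟨fun p => by simp [hJhat, hJ2, Prod.ext_iff], fun p q => ?_⟩
  have nijenhuis_eq : nijenhuis Jhat p q =
      (nijenhuis J p.1 q.1, nijenhuis J p.1 q.2 + nijenhuis J p.2 q.1) := by
    refine Prod.ext ?_ ?_ <;> simp only [nijenhuis, hJhat, tangent_lie_def, Prod.fst_add,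
      Prod.snd_add, Prod.fst_sub, Prod.snd_sub, map_add]
    abel
  rw [nijenhuis_eq]
  simp [hNJ]
end

section
/- Let 𝔤 be a finite-dimensional real Lie algebra admitting an ad-invariant positive definite inner product, i.e., an inner product ⟨·,·⟩ with ⟨⁅X,Y⁆, Z⟩ = −⟨Y, ⁅X,Z⁆⟩ for all X, Y, Z ∈ 𝔤 (equivalently, 𝔤 is the Lie algebra of a compact Lie group; 𝔤 may be odd or even dimensional). Then the tangent Lie algebra T𝔤 = 𝔤 × 𝔤 admits an integrable almost complex structure: there exists a real-linear map J : T𝔤 → T𝔤 with J² = −id and Nijenhuis tensor N_J identically zero. -/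
open Module

/-- Functional calculus for a diagonalizable endomorphism. -/
lemma exists_linearMap_eq_smul_of_eigenbasis {ι V : Type*} [AddCommGroup V] [Module ℝ V]
    (b : Basis ι ℝ V) (S : V →ₗ[ℝ] V) (μ : ι → ℝ) (hb : ∀ i, S (b i) = μ i • b i)
    (f : ℝ → ℝ) : ∃ R : V →ₗ[ℝ] V, ∀ (ν : ℝ) (v : V), S v = ν • v → R v = f ν • v := by
  refine ⟨b.constr ℝ fun i => f (μ i) • b i, fun ν v hv => b.repr.injective ?_⟩
  have coord (g : ι → ℝ) (T : V →ₗ[ℝ] V) (hT : ∀ i, T (b i) = g i • b i) (w : V) (i : ι) :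
      b.repr (T w) i = g i * b.repr w i := by
    have : b.coord i ∘ₗ T = g i • b.coord i := b.ext fun j => by
      by_cases h : j = i
      · simp [hT, h]
      · simp [hT, h]
    simpa using LinearMap.congr_fun this w
  ext i
  rw [coord (fun i => f (μ i)) _ (fun i => b.constr_basis ℝ _ i)]
  have h := coord μ S hb v i
  rw [hv] at h
  simp only [map_smul, Finsupp.smul_apply, smul_eq_mul] at h ⊢
  by_cases h0 : b.repr v i = 0
  · simp [h0]
  · rw [mul_right_cancel₀ h0 h]

/-- The spectral theorem for a symmetric positive definite bilinear form. -/
lemma exists_eigenbasis_of_symmetric {V : Type*} [AddCommGroup V] [Module ℝ V]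
    [FiniteDimensional ℝ V] (B : V →ₗ[ℝ] V →ₗ[ℝ] ℝ) (hsymm : ∀ x y, B x y = B y x)
    (hpos : ∀ x, x ≠ 0 → 0 < B x x) (S : V →ₗ[ℝ] V) (hS : ∀ x y, B (S x) y = B x (S y)) :
    ∃ (b : Basis (Fin (finrank ℝ V)) ℝ V) (μ : Fin (finrank ℝ V) → ℝ),
      ∀ i, S (b i) = μ i • b i := by
  let core : InnerProductSpace.Core ℝ V :=
    { inner := fun x y => B x y
      conj_inner_symm := fun x y => hsymm y x
      re_inner_nonneg := fun x => by
        by_cases h : x = 0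
        · simp [h]
        · exact (hpos x h).le
      add_left := fun x y z => by simp
      smul_left := fun x y r => by simp
      definite := fun x hx => by
        by_contra h
        exact (hpos x h).ne' hx }
  let : NormedAddCommGroup V := core.toNormedAddCommGroup
  let : InnerProductSpace ℝ V := InnerProductSpace.ofCore core.toCore
  have hT : S.IsSymmetric := hS
  refine ⟨(hT.eigenvectorBasis rfl).toBasis, hT.eigenvalues rfl, fun i => ?_⟩
  simp [hT.apply_eigenvectorBasis]

/-- The orthogonal factor of the polar decomposition of a skew-symmetric endomorphism. -/
lemma exists_polar_of_skew {V : Type*} [AddCommGroup V] [Module ℝ V]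
    [FiniteDimensional ℝ V] (B : V →ₗ[ℝ] V →ₗ[ℝ] ℝ) (hsymm : ∀ x y, B x y = B y x)
    (hpos : ∀ x, x ≠ 0 → 0 < B x x) (A : V →ₗ[ℝ] V) (hA : ∀ x y, B (A x) y = -B x (A y)) :
    ∃ J : V →ₗ[ℝ] V, (∀ x, J x = 0 ↔ A x = 0) ∧
      (∀ r : ℝ, 0 < r → ∀ x, A (A x) = -(r ^ 2 • x) → A x = r • J x) ∧
      (∀ T : V →ₗ[ℝ] V, (∀ x, T (A x) = A (T x)) → ∀ x, T (J x) = J (T x)) ∧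
      Submodule.span ℝ ({x | A x = 0} ∪ {x | ∃ r : ℝ, 0 < r ∧ A (A x) = -(r ^ 2 • x)}) = ⊤ := by
  obtain ⟨b, μ, hb⟩ := exists_eigenbasis_of_symmetric B hsymm hpos (-(A ∘ₗ A))
    (fun x y => by simp [hA])
  simp only [LinearMap.neg_apply, LinearMap.comp_apply] at hb
  have hker (x : V) (h : A (A x) = 0) : A x = 0 := by
    by_contra h0
    have := hpos _ h0
    simp [hA, h] at this
  have hμ (i) : 0 ≤ μ i := by
    have h1 := hpos _ (b.ne_zero i)
    have h2 : 0 ≤ B (A (b i)) (A (b i)) := by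
      by_cases h : A (b i) = 0
      · simp [h]
      · exact (hpos _ h).le
    rw [hA, ← map_neg, hb, map_smul, smul_eq_mul] at h2
    exact nonneg_of_mul_nonneg_left h2 h1
  have calculus := exists_linearMap_eq_smul_of_eigenbasis b (-(A ∘ₗ A)) μ hb
  simp only [LinearMap.neg_apply, LinearMap.comp_apply] at calculus
  obtain ⟨R, hR⟩ := calculus fun t => (√t)⁻¹
  obtain ⟨Q, hQ⟩ := calculus fun t => √t
  have comm (f : ℝ → ℝ) (P : V →ₗ[ℝ] V) (hP : ∀ (ν : ℝ) v, -A (A v) = ν • v → P v = f ν • v)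
      (T : V →ₗ[ℝ] V) (hT : ∀ x, T (A x) = A (T x)) (x : V) : T (P x) = P (T x) := by
    have : T ∘ₗ P = P ∘ₗ T := b.ext fun i => by
      have h : -A (A (T (b i))) = μ i • T (b i) := by
        rw [← hT, ← hT, ← map_neg, hb, map_smul]
      simp [hP _ _ (hb i), hP _ _ h]
    exact LinearMap.congr_fun this x
  refine ⟨A ∘ₗ R, fun x => ⟨fun h => ?_, fun h => ?_⟩, fun r hr x hx => ?_,
    fun T hT x => ?_, ?_⟩
  · have h1 : A = A ∘ₗ R ∘ₗ Q := b.ext fun i => by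
      simp only [LinearMap.comp_apply, hR _ _ (hb i), hQ _ _ (hb i), map_smul, smul_smul]
      rcases (hμ i).eq_or_lt with h0 | h0
      · have := hb i
        rw [← h0, zero_smul, neg_eq_zero] at this
        simp [hker _ this]
      · rw [mul_inv_cancel₀ (Real.sqrt_pos.2 h0).ne', one_smul]
    have hRA := comm _ R hR A fun _ => rfl
    have hQA := comm _ Q hQ A fun _ => rfl
    have hQR := comm _ R hR Q fun x => (hQA x).symm
    rw [h1]
    simp only [LinearMap.comp_apply] at h ⊢
    rw [← hQR, hQA, h, map_zero]
  · simp [hR 0 x (by simp [h])]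
  · have := hR (r ^ 2) x (by simp [hx])
    simp only [LinearMap.comp_apply, this, map_smul, Real.sqrt_sq hr.le]
    rw [smul_inv_smul₀ hr.ne']
  · simp [hT, comm _ R hR T hT]
  · rw [eq_top_iff, ← b.span_eq, Submodule.span_le]
    rintro _ ⟨i, rfl⟩
    refine Submodule.subset_span ?_
    rcases (hμ i).eq_or_lt with h0 | h0
    · have := hb i
      rw [← h0, zero_smul, neg_eq_zero] at this
      exact Or.inl (hker _ this)
    · refine Or.inr ⟨√(μ i), Real.sqrt_pos.2 h0, ?_⟩
      rw [Real.sq_sqrt h0.le, ← hb, neg_neg]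

/-- A Lie algebra with an ad-invariant inner product contains an element whose centralizer is
abelian. -/
lemma exists_centralizer_abelian_of_invariant {L : Type*} [LieRing L] [LieAlgebra ℝ L]
    [FiniteDimensional ℝ L] (B : L →ₗ[ℝ] L →ₗ[ℝ] ℝ) (hpos : ∀ X : L, X ≠ 0 → 0 < B X X)
    (hinv : ∀ X Y Z : L, B ⁅X, Y⁆ Z = -B Y ⁅X, Z⁆) :
    ∃ H : L, ∀ X Y : L, ⁅H, X⁆ = 0 → ⁅H, Y⁆ = 0 → ⁅X, Y⁆ = 0 := by
  obtain ⟨H, hH⟩ := LieAlgebra.exists_isCartanSubalgebra_engel ℝ L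
  have hpow (X Y : L) (n : ℕ) (h : (LieAlgebra.ad ℝ L X ^ n) Y = 0) : ⁅X, Y⁆ = 0 := by
    induction n with
    | zero => simp_all
    | succ n ih =>
      rcases n with _ | n
      · simpa using h
      · refine ih ?_
        by_contra h0
        have := hpos _ h0
        rw [pow_succ', Module.End.mul_apply, LieAlgebra.ad_apply] at h
        nth_rw 1 [pow_succ'] at this
        rw [Module.End.mul_apply, LieAlgebra.ad_apply, hinv, h, map_zero, neg_zero] at this
        exact this.false
  refine ⟨H, fun X Y hX hY => ?_⟩
  have mem (Z : L) (hZ : ⁅H, Z⁆ = 0) : Z ∈ LieSubalgebra.engel ℝ H :=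
    (LieSubalgebra.mem_engel_iff ℝ H Z).2 ⟨1, by simpa using hZ⟩
  obtain ⟨n, hn⟩ := LieModule.exists_forall_pow_toEnd_eq_zero ℝ
    (LieSubalgebra.engel ℝ H) (LieSubalgebra.engel ℝ H)
  refine hpow X Y n ?_
  have h := congrArg Subtype.val (LinearMap.congr_fun (hn ⟨X, mem X hX⟩) ⟨Y, mem Y hY⟩)
  have coe (m : ℕ) (Z : LieSubalgebra.engel ℝ H) :
      (((LieModule.toEnd ℝ (LieSubalgebra.engel ℝ H) (LieSubalgebra.engel ℝ H)
        ⟨X, mem X hX⟩ ^ m) Z : LieSubalgebra.engel ℝ H) : L) = (LieAlgebra.ad ℝ L X ^ m) Z := by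
    induction m with
    | zero => rfl
    | succ m ih => rw [pow_succ', pow_succ', Module.End.mul_apply, Module.End.mul_apply, ← ih]; rfl
  rwa [coe] at h

/-- A Lie algebra with an ad-invariant inner product carries an endomorphism `J` whose kernel is
abelian, with `J` commuting with the adjoint action of its kernel, and which restricts to an
integrable complex structure on its range. -/
lemma exists_integrable_of_invariant {L : Type*} [LieRing L] [LieAlgebra ℝ L]
    [FiniteDimensional ℝ L] (B : L →ₗ[ℝ] L →ₗ[ℝ] ℝ) (hsymm : ∀ X Y : L, B X Y = B Y X)
    (hpos : ∀ X : L, X ≠ 0 → 0 < B X X) (hinv : ∀ X Y Z : L, B ⁅X, Y⁆ Z = -B Y ⁅X, Z⁆) :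
    ∃ J : L →ₗ[ℝ] L, (∀ X, J (J (J X)) = -J X) ∧
      (∀ X Y, J X = 0 → J Y = 0 → ⁅X, Y⁆ = 0) ∧
      (∀ X Y, J X = 0 → J ⁅X, Y⁆ = ⁅X, J Y⁆) ∧
      (∀ X Y, J (J X) = -X → J (J Y) = -Y →
        J ⁅J X, Y⁆ + J ⁅X, J Y⁆ = ⁅J X, J Y⁆ - ⁅X, Y⁆) := by
  obtain ⟨H, hH⟩ := exists_centralizer_abelian_of_invariant B hpos hinv
  obtain ⟨J, hker, hJ, hcomm, hspan⟩ :=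
    exists_polar_of_skew B hsymm hpos (LieAlgebra.ad ℝ L H) (hinv H)
  simp only [LieAlgebra.ad_apply] at hker hJ hcomm hspan
  have hHJ (X : L) : ⁅H, J X⁆ = J ⁅H, X⁆ := hcomm (LieAlgebra.ad ℝ L H) (fun _ => rfl) X
  have hsq (r : ℝ) (hr : 0 < r) (X : L) (hX : ⁅H, ⁅H, X⁆⁆ = -(r ^ 2 • X)) : J (J X) = -X := by
    have h1 := hJ r hr X hX
    have h2 : r • r • J (J X) = r • r • -X := by
      have h3 : ⁅H, ⁅H, X⁆⁆ = r • r • J (J X) := by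
        rw [h1, lie_smul, hHJ, h1, map_smul]
      rw [← h3, hX, smul_smul, smul_neg, sq]
    exact smul_right_injective L hr.ne' (smul_right_injective L hr.ne' h2)
  have integrable (X Y : L) : J (⁅J (J X), J Y⁆ + ⁅J X, J (J Y)⁆)
      = ⁅J (J X), J (J Y)⁆ - ⁅J X, J Y⁆ := by
    have hX : X ∈ (⊤ : Submodule ℝ L) := trivial
    have hY : Y ∈ (⊤ : Submodule ℝ L) := trivial
    rw [← hspan] at hX hY
    induction hX, hY using Submodule.span_induction₂ with
    | zero_left => simp
    | zero_right => simp
    | add_left X X' Y _ _ _ h h' =>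
      simp only [map_add, add_lie] at h h' ⊢
      rw [add_add_add_comm, h, h']; abel
    | add_right X Y Y' _ _ _ h h' =>
      simp only [map_add, lie_add] at h h' ⊢
      rw [add_add_add_comm, h, h']; abel
    | smul_left r X Y _ _ h =>
      simp only [map_smul, smul_lie, ← smul_add, ← smul_sub, h]
    | smul_right r X Y _ _ h =>
      simp only [map_smul, lie_smul, ← smul_add, ← smul_sub, h]
    | mem_mem X Y hX hY =>
      rcases hX with hX | ⟨r, hr, hX⟩
      · simp [(hker X).2 hX]
      rcases hY with hY | ⟨s, hs, hY⟩
      · simp [(hker Y).2 hY]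
      have hrs : 0 < r + s := add_pos hr hs
      have hX2 := hsq r hr X hX
      have hY2 := hsq s hs Y hY
      have hX1 := hJ r hr X hX
      have hY1 := hJ s hs Y hY
      have hX3 : ⁅H, J X⁆ = -(r • X) := by rw [hHJ, hX1, map_smul, hX2, smul_neg]
      have hY3 : ⁅H, J Y⁆ = -(s • Y) := by rw [hHJ, hY1, map_smul, hY2, smul_neg]
      rw [hX2, hY2]
      have hW : ⁅H, ⁅-X, J Y⁆ + ⁅J X, -Y⁆⁆ = (r + s) • (⁅-X, -Y⁆ - ⁅J X, J Y⁆) := by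
        simp only [lie_add, leibniz_lie H, lie_neg, neg_lie, hX1, hY1, hX3, hY3, smul_lie, lie_smul]
        module
      have hZ : ⁅H, ⁅-X, -Y⁆ - ⁅J X, J Y⁆⁆ = -((r + s) • (⁅-X, J Y⁆ + ⁅J X, -Y⁆)) := by
        simp only [lie_sub, leibniz_lie H, lie_neg, neg_lie, hX1, hY1, hX3, hY3, smul_lie, lie_smul]
        module
      have h := hJ (r + s) hrs (⁅-X, J Y⁆ + ⁅J X, -Y⁆)
        (by rw [hW, lie_smul, hZ, smul_neg, smul_smul, sq])
      rw [hW] at h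
      exact (smul_right_injective L hrs.ne' h).symm
  refine ⟨J, fun X => ?_, fun X Y hX hY => hH X Y ((hker X).1 hX) ((hker Y).1 hY),
    fun X Y hX => ?_, fun X Y hX hY => ?_⟩
  · have hX : X ∈ (⊤ : Submodule ℝ L) := trivial
    rw [← hspan] at hX
    induction hX using Submodule.span_induction with
    | zero => simp
    | add X Y _ _ h h' => simp only [map_add, h, h', neg_add]
    | smul r X _ h => simp only [map_smul, h, smul_neg]
    | mem X hX =>
      rcases hX with hX | ⟨r, hr, hX⟩
      · simp [(hker X).2 hX]
      · rw [hsq r hr X hX, map_neg]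
  · refine (hcomm (LieAlgebra.ad ℝ L X) (fun Z => ?_) Y).symm
    have : ⁅H, X⁆ = 0 := (hker X).1 hX
    simp [leibniz_lie H X Z, this]
  · have := integrable (J X) (J Y)
    simp only [hX, hY, map_neg, lie_neg, neg_lie, neg_neg, map_add] at this
    exact this

/-- The bracket of the tangent Lie algebra in components. -/
lemma tangent_lie_mk {L : Type*} [LieRing L] (a b c d : L) :
    ⁅((a, b) : L × L), ((c, d) : L × L)⁆ = (⁅a, c⁆, ⁅a, d⁆ + ⁅b, c⁆) := rfl

/-- If a finite-dimensional real Lie algebra `𝔤` admits an ad-invariant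
positive definite inner product (equivalently, `𝔤` is the Lie algebra of a compact Lie group),
then the tangent Lie algebra `T𝔤 = 𝔤 × 𝔤` admits an integrable almost complex structure. -/
theorem tangent_lie_algebra_admits_complex_structure
    (L : Type*) [LieRing L] [LieAlgebra ℝ L] [FiniteDimensional ℝ L]
    (B : L →ₗ[ℝ] L →ₗ[ℝ] ℝ)
    (hsymm : ∀ X Y : L, B X Y = B Y X)
    (hpos : ∀ X : L, X ≠ 0 → 0 < B X X)
    (hinv : ∀ X Y Z : L, B ⁅X, Y⁆ Z = -B Y ⁅X, Z⁆) :
    ∃ J : L × L →ₗ[ℝ] L × L,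
      (∀ p : L × L, J (J p) = -p) ∧ (∀ p q : L × L, nijenhuis J p q = 0) := by
  obtain ⟨J, hJ3, hab, hcomm, hnij⟩ := exists_integrable_of_invariant B hsymm hpos hinv
  let P : L →ₗ[ℝ] L := LinearMap.id + J ∘ₗ J
  have hP (X : L) : P X = X + J (J X) := rfl
  let K : L × L →ₗ[ℝ] L × L :=
    (J ∘ₗ LinearMap.fst ℝ L L - P ∘ₗ LinearMap.snd ℝ L L).prod
      (J ∘ₗ LinearMap.snd ℝ L L + P ∘ₗ LinearMap.fst ℝ L L)
  have hK (X Y : L) : K (X, Y) = (J X - P Y, J Y + P X) := rfl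
  have hJP (X : L) : J (P X) = 0 := by rw [hP, map_add, hJ3, add_neg_cancel]
  have hPP (u : L) (hu : J u = 0) : P u = u := by rw [hP, hu, map_zero, add_zero]
  have hPm (m : L) (hm : J (J m) = -m) : P m = 0 := by rw [hP, hm, add_neg_cancel]
  refine ⟨K, fun p => ?_, fun p q => ?_⟩
  · obtain ⟨X, Y⟩ := p
    have hPJ (X : L) : P (J X) = 0 := hPm _ (hJ3 X)
    simp only [hK, map_add, map_sub, hPJ, hJP, hPP _ (hJP _), Prod.neg_mk]
    simp only [hP]
    ext <;> simp
  · have split (X : L) : ∃ u m, J u = 0 ∧ J (J m) = -m ∧ X = u + m :=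
      ⟨P X, -J (J X), hJP X, by simp [hJ3], by simp [hP]⟩
    have hcomm' (u Y : L) (hu : J u = 0) : J ⁅Y, u⁆ = ⁅J Y, u⁆ := by
      rw [← lie_skew, map_neg, hcomm u Y hu, lie_skew]
    obtain ⟨X₁, X₂⟩ := p
    obtain ⟨Y₁, Y₂⟩ := q
    obtain ⟨u₁, m₁, hu₁, hm₁, rfl⟩ := split X₁
    obtain ⟨u₂, m₂, hu₂, hm₂, rfl⟩ := split X₂
    obtain ⟨v₁, n₁, hv₁, hn₁, rfl⟩ := split Y₁
    obtain ⟨v₂, n₂, hv₂, hn₂, rfl⟩ := split Y₂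
    have hPmn (m n : L) (hm : J (J m) = -m) (hn : J (J n) = -n) :
        P ⁅J m, n⁆ = -P ⁅m, J n⁆ := by
      rw [eq_neg_iff_add_eq_zero, ← map_add]
      refine hPm _ ?_
      have h := hnij (J m) n (by rw [hm, map_neg]) hn
      rw [map_add J ⁅J m, n⁆, hnij m n hm hn, map_sub]
      rw [hm, neg_lie, map_neg, neg_lie, neg_add_eq_sub] at h
      rw [h]
      abel
    have hnij' (m n : L) (hm : J (J m) = -m) (hn : J (J n) = -n) :
        J ⁅J m, n⁆ = ⁅J m, J n⁆ - ⁅m, n⁆ - J ⁅m, J n⁆ :=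
      eq_sub_of_add_eq (hnij m n hm hn)
    simp only [nijenhuis, hK, tangent_lie_mk, map_add, map_sub, lie_add, add_lie, lie_sub,
      sub_lie, hPP, hPm, hab, hcomm, hcomm', hnij', hPmn, hu₁, hu₂, hv₁, hv₂,
      hm₁, hm₂, hn₁, hn₂, map_zero, map_neg, lie_neg, neg_lie,
      Prod.mk_add_mk, Prod.mk_sub_mk, Prod.mk_eq_zero]
    constructor <;> abel
end

section
/- Let 𝔤 be a finite-dimensional real Lie algebra admitting an ad-invariant positive definite inner product (⟨⁅X,Y⁆, Z⟩ = −⟨Y, ⁅X,Z⁆⟩ for all X, Y, Z). Define the iterated tangent Lie algebras by T⁰𝔤 := 𝔤 and T^k𝔤 := T(T^{k−1}𝔤) for k ≥ 1. Then for every k ≥ 1, the Lie algebra T^k𝔤 admits an integrable almost complex structure: a real-linear map J : T^k𝔤 → T^k𝔤 with J² = −id and vanishing Nijenhuis tensor. -/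
/-- Iterated tangent Lie algebras: `T⁰𝔤 = 𝔤` and `T^(k+1)𝔤 = T^k𝔤 × T^k𝔤`. -/
def Tpow (L : Type u) : ℕ → Type u
  | 0 => L
  | k + 1 => Tpow L k × Tpow L k

instance TpowLieRing (L : Type u) [LieRing L] : (k : ℕ) → LieRing (Tpow L k)
  | 0 => inferInstanceAs (LieRing L)
  | k + 1 => letI := TpowLieRing L k; inferInstanceAs (LieRing (Tpow L k × Tpow L k))

instance TpowLieAlgebra (R : Type*) (L : Type u) [CommRing R] [LieRing L] [LieAlgebra R L] :
    (k : ℕ) → LieAlgebra R (Tpow L k)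
  | 0 => inferInstanceAs (LieAlgebra R L)
  | k + 1 => letI := TpowLieAlgebra R L k
             inferInstanceAs (LieAlgebra R (Tpow L k × Tpow L k))

/-- Functional calculus on eigenvectors: every `f : ℝ → ℝ` is realized by an endomorphism acting
as `f μ` on each eigenspace of `S`. -/
theorem exists_end_apply_eigenvector {M : Type*} [AddCommGroup M] [Module ℝ M]
    [FiniteDimensional ℝ M] (S : Module.End ℝ M) (f : ℝ → ℝ) :
    ∃ F : Module.End ℝ M, ∀ (μ : ℝ) (v : M), S v = μ • v → F v = f μ • v := by
  have hfin : Set.Finite {μ | S.HasEigenvalue μ} := Module.End.finite_hasEigenvalue S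
  refine ⟨Polynomial.aeval S (Lagrange.interpolate hfin.toFinset id f), fun μ v hv => ?_⟩
  by_cases h0 : v = 0
  · simp [h0]
  have hev : S.HasEigenvector μ v := ⟨Module.End.mem_eigenspace_iff.mpr hv, h0⟩
  rw [Module.End.aeval_apply_of_hasEigenvector hev]
  congr 1
  refine Lagrange.eval_interpolate_at_node (v := id) f Function.injective_id.injOn
    (i := μ) ?_
  simpa using Module.End.hasEigenvalue_of_hasEigenvector hev

/-- An endomorphism that is skew for a positive definite form is diagonalizable over `ℂ` with
imaginary eigenvalues, in the following real form. -/
theorem span_eigenvectors_sq_of_skew {M : Type*} [AddCommGroup M] [Module ℝ M]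
    [FiniteDimensional ℝ M] (B : M →ₗ[ℝ] M →ₗ[ℝ] ℝ)
    (hsymm : ∀ x y, B x y = B y x) (hpos : ∀ x, x ≠ 0 → 0 < B x x)
    (D : M →ₗ[ℝ] M) (hD : ∀ x y, B (D x) y = -B x (D y)) :
    Submodule.span ℝ {v : M | D v = 0 ∨ ∃ c : ℝ, 0 < c ∧ D (D v) = -(c ^ 2) • v} = ⊤ := by
  have hnonneg : ∀ x, 0 ≤ B x x := fun x => by
    by_cases hx : x = 0
    · simp [hx]
    · exact (hpos x hx).le
  let core : InnerProductSpace.Core ℝ M :=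
    { inner := fun x y => B x y
      conj_inner_symm := fun x y => by simpa using hsymm y x
      re_inner_nonneg := fun x => by simpa using hnonneg x
      add_left := fun x y z => by simp
      smul_left := fun x y r => by simp
      definite := fun x hx => by
        by_contra h
        exact (hpos x h).ne' hx }
  let _ : NormedAddCommGroup M := core.toNormedAddCommGroup
  let _ : InnerProductSpace ℝ M := InnerProductSpace.ofCore core.toCore
  have hS : (D ∘ₗ D).IsSymmetric := fun x y => by
    change B (D (D x)) y = B x (D (D y))
    rw [hD, hD, neg_neg]
  let b := hS.eigenvectorBasis rfl
  rw [eq_top_iff, ← b.toBasis.span_eq]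
  refine Submodule.span_mono ?_
  rintro _ ⟨i, rfl⟩
  set v := b.toBasis i with hv
  have hne : v ≠ 0 := b.toBasis.ne_zero i
  obtain ⟨μ, hμ⟩ : ∃ μ : ℝ, D (D v) = μ • v := by
    refine ⟨hS.eigenvalues rfl i, ?_⟩
    have := hS.apply_eigenvectorBasis rfl i
    rw [← OrthonormalBasis.coe_toBasis] at this
    exact this
  have hB : B (D v) (D v) = -μ * B v v := by
    have := hD (D v) v
    rw [hμ] at this
    simp only [map_smul, LinearMap.smul_apply, smul_eq_mul] at this
    linarith
  have hvv := hpos v hne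
  rcases lt_or_ge μ 0 with h | h
  · refine Or.inr ⟨√(-μ), Real.sqrt_pos.mpr (by linarith), ?_⟩
    rw [hμ, Real.sq_sqrt (by linarith), neg_neg]
  · left
    by_contra h0
    have := hpos _ h0
    nlinarith [mul_nonneg h hvv.le]

section Nijenhuis

variable {M : Type*} [LieRing M] [LieAlgebra ℝ M]

theorem nijenhuis_add_left (J : M →ₗ[ℝ] M) (x y z : M) :
    nijenhuis J (x + y) z = nijenhuis J x z + nijenhuis J y z := by
  simp only [nijenhuis, map_add, add_lie]
  abel

theorem nijenhuis_smul_left (J : M →ₗ[ℝ] M) (c : ℝ) (x z : M) :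
    nijenhuis J (c • x) z = c • nijenhuis J x z := by
  simp only [nijenhuis, map_smul, smul_lie, smul_add, smul_sub]

theorem nijenhuis_swap (J : M →ₗ[ℝ] M) (x y : M) :
    nijenhuis J y x = -nijenhuis J x y := by
  simp only [nijenhuis]
  rw [← lie_skew x (J y), ← lie_skew (J x) y, ← lie_skew x y, ← lie_skew (J x) (J y)]
  simp only [map_neg]
  abel

theorem nijenhuis_eq_zero_of_span (J : M →ₗ[ℝ] M) (s : Set M)
    (hs : Submodule.span ℝ s = ⊤) (h : ∀ x ∈ s, ∀ y ∈ s, nijenhuis J x y = 0) (x y : M) :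
    nijenhuis J x y = 0 := by
  have key : ∀ z, (∀ x ∈ s, nijenhuis J x z = 0) → ∀ x, nijenhuis J x z = 0 := by
    intro z hz x
    have hx : x ∈ Submodule.span ℝ s := hs ▸ Submodule.mem_top
    induction hx using Submodule.span_induction with
    | mem x hx => exact hz x hx
    | zero => simpa using nijenhuis_smul_left J 0 0 z
    | add x y _ _ hx hy => rw [nijenhuis_add_left, hx, hy, add_zero]
    | smul c x _ hx => rw [nijenhuis_smul_left, hx, smul_zero]
  refine key y (fun x hx => ?_) x
  rw [nijenhuis_swap, neg_eq_zero]
  exact key x (fun y hy => h y hy x hx) y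

/-- If `D` is a derivation that is skew for a positive definite form, an integrable almost complex
structure on `ker D` extends to the whole Lie algebra, by the polar part of `D` on `im D`. -/
theorem exists_complex_structure_of_ker [FiniteDimensional ℝ M]
    (B : M →ₗ[ℝ] M →ₗ[ℝ] ℝ)
    (hsymm : ∀ x y, B x y = B y x) (hpos : ∀ x, x ≠ 0 → 0 < B x x)
    (D : M →ₗ[ℝ] M) (hD : ∀ x y, B (D x) y = -B x (D y))
    (hder : ∀ x y : M, D ⁅x, y⁆ = ⁅D x, y⁆ + ⁅x, D y⁆)
    (J₀ : M →ₗ[ℝ] M) (hker : ∀ x, D x = 0 → D (J₀ x) = 0)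
    (hsq : ∀ x, D x = 0 → J₀ (J₀ x) = -x)
    (hN : ∀ x y, D x = 0 → D y = 0 → nijenhuis J₀ x y = 0) :
    ∃ J : M →ₗ[ℝ] M, (∀ x, J (J x) = -x) ∧ ∀ x y, nijenhuis J x y = 0 := by
  have hspan := span_eigenvectors_sq_of_skew B hsymm hpos D hD
  obtain ⟨F, hF⟩ := exists_end_apply_eigenvector (D ∘ₗ D) (fun μ => (√(-μ))⁻¹)
  obtain ⟨P, hP⟩ := exists_end_apply_eigenvector (D ∘ₗ D) (fun μ => if μ = 0 then 1 else 0)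
  let J : M →ₗ[ℝ] M := D ∘ₗ F + J₀ ∘ₗ P
  have hJ₀ : ∀ x, D x = 0 → J x = J₀ x := by
    intro x hx
    have h1 := hF 0 x (by simp [hx])
    have h2 := hP 0 x (by simp [hx])
    simp [J, h1, h2]
  have hJ : ∀ (c : ℝ) (x : M), 0 < c → D (D x) = -(c ^ 2) • x → J x = c⁻¹ • D x := by
    intro c x hc hx
    have h1 := hF (-(c ^ 2)) x hx
    have h2 := hP (-(c ^ 2)) x hx
    simp only [neg_neg, Real.sqrt_sq hc.le] at h1
    rw [if_neg (neg_ne_zero.mpr (pow_pos hc 2).ne'), zero_smul] at h2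
    simp [J, h1, h2]
  have hDJ : ∀ (c : ℝ) (x : M), 0 < c → D (D x) = -(c ^ 2) • x → D x = c • J x := by
    intro c x hc hx
    rw [hJ c x hc hx, smul_inv_smul₀ hc.ne']
  have hJD : ∀ (c : ℝ) (x : M), 0 < c → D (D x) = -(c ^ 2) • x → D (J x) = -c • x := by
    intro c x hc hx
    rw [hJ c x hc hx, map_smul, hx, smul_smul]
    congr 1
    field_simp
  have hJJ : ∀ (c : ℝ) (x : M), 0 < c → D (D x) = -(c ^ 2) • x → J (J x) = -x := by
    intro c x hc hx
    have h : D (D (J x)) = -(c ^ 2) • J x := by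
      rw [hJD c x hc hx, map_smul, hDJ c x hc hx, smul_smul]
      congr 1
      ring
    rw [hJ c (J x) hc h, hJD c x hc hx, smul_smul]
    simp [hc.ne']
  have hmixed : ∀ (c : ℝ) (x y : M), 0 < c → D x = 0 → D (D y) = -(c ^ 2) • y →
      J ⁅x, y⁆ = ⁅x, J y⁆ := by
    intro c x y hc hx hy
    have h1 : ∀ z, D ⁅x, z⁆ = ⁅x, D z⁆ := fun z => by rw [hder, hx, zero_lie, zero_add]
    rw [hJ c _ hc (by rw [h1, h1, hy, lie_smul]), h1, hJ c y hc hy, lie_smul]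
  have hN' : ∀ (c : ℝ) (x y : M), 0 < c → D x = 0 → D (D y) = -(c ^ 2) • y →
      nijenhuis J x y = 0 := by
    intro c x y hc hx hy
    have hJx : D (J x) = 0 := by rw [hJ₀ x hx]; exact hker x hx
    rw [nijenhuis, ← hmixed c x y hc hx hy, hmixed c (J x) y hc hJx hy]
    have h : J (J ⁅x, y⁆) = -⁅x, y⁆ := by
      refine hJJ c _ hc ?_
      rw [hder, hx, zero_lie, zero_add, hder, hx, zero_lie, zero_add, hy, lie_smul]
    rw [h]
    abel
  refine ⟨J, fun x => ?_, nijenhuis_eq_zero_of_span J _ hspan ?_⟩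
  · have hx : x ∈ Submodule.span ℝ _ := hspan ▸ Submodule.mem_top
    induction hx using Submodule.span_induction with
    | mem x hx =>
      rcases hx with hx | ⟨c, hc, hx⟩
      · rw [hJ₀ x hx, hJ₀ _ (hker x hx), hsq x hx]
      · exact hJJ c x hc hx
    | zero => simp
    | add x y _ _ hx hy => rw [map_add, map_add, hx, hy, neg_add]
    | smul c x _ hx => rw [map_smul, map_smul, hx, smul_neg]
  · rintro x (hx | ⟨a, ha, hx⟩) y (hy | ⟨b, hb, hy⟩)
    · have hb : ∀ u v, D u = 0 → D v = 0 → D ⁅u, v⁆ = 0 := fun u v hu hv => by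
        rw [hder, hu, hv, zero_lie, lie_zero, add_zero]
      rw [nijenhuis, hJ₀ x hx, hJ₀ y hy, hJ₀ _ (hb _ _ (hker x hx) hy),
        hJ₀ _ (hb _ _ hx (hker y hy))]
      exact hN x y hx hy
    · exact hN' b x y hb hx hy
    · rw [nijenhuis_swap, hN' a y x ha hy hx, neg_zero]
    · have hab : 0 < a + b := add_pos ha hb
      have hDU : D (⁅J x, y⁆ + ⁅x, J y⁆) = -(a + b) • (⁅x, y⁆ - ⁅J x, J y⁆) := by
        rw [map_add, hder, hder, hJD a x ha hx, hJD b y hb hy, hDJ a x ha hx, hDJ b y hb hy]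
        simp only [smul_lie, lie_smul]
        module
      have hDV : D (⁅x, y⁆ - ⁅J x, J y⁆) = (a + b) • (⁅J x, y⁆ + ⁅x, J y⁆) := by
        rw [map_sub, hder, hder, hJD a x ha hx, hJD b y hb hy, hDJ a x ha hx, hDJ b y hb hy]
        simp only [smul_lie, lie_smul]
        module
      have hJU : J (⁅J x, y⁆ + ⁅x, J y⁆) = -(⁅x, y⁆ - ⁅J x, J y⁆) := by
        rw [hJ (a + b) _ hab, hDU, neg_smul, smul_neg, inv_smul_smul₀ hab.ne']
        · rw [hDU, map_smul, hDV, smul_smul]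
          congr 1
          ring
      rw [nijenhuis, ← map_add, hJU]
      abel

end Nijenhuis

theorem tangent_lie_def_s10 {L : Type*} [LieRing L] (x y : L × L) :
    ⁅x, y⁆ = (⁅x.1, y.1⁆, ⁅x.1, y.2⁆ + ⁅x.2, y.1⁆) := rfl

/-- The tangent Lie algebra of an abelian Lie algebra has an integrable almost complex
structure. -/
theorem tangent_exists_complex_structure_of_abelian {L : Type*} [LieRing L] [LieAlgebra ℝ L]
    (h : ∀ x y : L, ⁅x, y⁆ = 0) :
    ∃ J : L × L →ₗ[ℝ] L × L, (∀ p, J (J p) = -p) ∧ ∀ p q, nijenhuis J p q = 0 := by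
  refine ⟨(-LinearMap.snd ℝ L L).prod (LinearMap.fst ℝ L L), fun p => ?_, fun p q => ?_⟩
  · ext <;> simp
  · have h' : ∀ u v : L × L, ⁅u, v⁆ = 0 := fun u v => by simp [tangent_lie_def_s10, h]
    simp only [nijenhuis, h', map_zero, add_zero, sub_zero]

/-- The tangent Lie algebra of a Lie algebra with an ad-invariant inner product has an integrable
almost complex structure. -/
theorem tangent_exists_complex_structure (n : ℕ) :
    ∀ (L : Type u) [LieRing L] [LieAlgebra ℝ L] [FiniteDimensional ℝ L]
    (B : L →ₗ[ℝ] L →ₗ[ℝ] ℝ), Module.finrank ℝ L = n →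
    (∀ X Y : L, B X Y = B Y X) → (∀ X : L, X ≠ 0 → 0 < B X X) →
    (∀ X Y Z : L, B ⁅X, Y⁆ Z = -B Y ⁅X, Z⁆) →
    ∃ J : L × L →ₗ[ℝ] L × L, (∀ p, J (J p) = -p) ∧ ∀ p q, nijenhuis J p q = 0 := by
  induction n using Nat.strong_induction_on with
  | _ n ih =>
  intro L _ _ _ B hn hsymm hpos hinv
  by_cases hab : ∀ x y : L, ⁅x, y⁆ = 0
  · exact tangent_exists_complex_structure_of_abelian hab
  push Not at hab
  obtain ⟨H, Y, hHY⟩ := hab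
  let K : LieSubalgebra ℝ L :=
    { LinearMap.ker (LieAlgebra.ad ℝ L H) with
      lie_mem' := fun {x y} hx hy => by
        have hx' : ⁅H, x⁆ = 0 := hx
        have hy' : ⁅H, y⁆ = 0 := hy
        change ⁅H, ⁅x, y⁆⁆ = 0
        rw [leibniz_lie, hx', hy', zero_lie, lie_zero, add_zero] }
  have hK : ∀ x, x ∈ K ↔ ⁅H, x⁆ = 0 := fun x => Iff.rfl
  have hlt : Module.finrank ℝ K < n := by
    rw [← hn]
    refine Submodule.finrank_lt (s := K.toSubmodule) fun htop => hHY ?_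
    exact (hK Y).mp (show Y ∈ K.toSubmodule from htop ▸ Submodule.mem_top)
  let ι : K →ₗ[ℝ] L := K.toSubmodule.subtype
  obtain ⟨J, hJJ, hJN⟩ := ih _ hlt K (B.compl₁₂ ι ι) rfl (fun x y => hsymm _ _)
    (fun x hx => hpos _ fun h => hx (Subtype.ext h)) (fun x y z => hinv _ _ _)
  obtain ⟨π, hπ⟩ := ι.exists_leftInverse_of_injective
    (LinearMap.ker_eq_bot.mpr K.toSubmodule.injective_subtype)
  have hπι : ∀ x : K, π (ι x) = x := fun x => LinearMap.congr_fun hπ x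
  let D : L →ₗ[ℝ] L := LieAlgebra.ad ℝ L H
  have hDι : ∀ x : K, ⁅H, ι x⁆ = 0 := fun x => x.2
  let ι₂ := ι.prodMap ι
  have hlie : ∀ p q : K × K, ⁅ι₂ p, ι₂ q⁆ = ι₂ ⁅p, q⁆ := fun p q => rfl
  have hlift : ∀ p : L × L, D.prodMap D p = 0 → ∃ q : K × K, p = ι₂ q := by
    intro p hp
    exact ⟨(⟨p.1, congrArg Prod.fst hp⟩, ⟨p.2, congrArg Prod.snd hp⟩), rfl⟩
  let J₀ := ι₂ ∘ₗ J ∘ₗ π.prodMap π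
  have hJ₀ : ∀ q : K × K, J₀ (ι₂ q) = ι₂ (J q) := by
    intro q
    have : (π.prodMap π) (ι₂ q) = q := Prod.ext (hπι _) (hπι _)
    simp only [J₀, LinearMap.comp_apply, this]
  refine exists_complex_structure_of_ker
    (B.compl₁₂ (LinearMap.fst ℝ L L) (LinearMap.fst ℝ L L) +
      B.compl₁₂ (LinearMap.snd ℝ L L) (LinearMap.snd ℝ L L))
    (fun p q => ?_) (fun p hp => ?_) (D.prodMap D) (fun p q => ?_) (fun p q => ?_)
    J₀ (fun p hp => ?_) (fun p hp => ?_) (fun p q hp hq => ?_)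
  · simp [hsymm p.1, hsymm p.2]
  · have hnonneg : ∀ x, 0 ≤ B x x := fun x => by
      by_cases hx : x = 0
      · simp [hx]
      · exact (hpos x hx).le
    change 0 < B p.1 p.1 + B p.2 p.2
    by_cases h1 : p.1 = 0
    · exact add_pos_of_nonneg_of_pos (hnonneg _) (hpos _ fun h2 => hp (Prod.ext h1 h2))
    · exact add_pos_of_pos_of_nonneg (hpos _ h1) (hnonneg _)
  · change B ⁅H, p.1⁆ q.1 + B ⁅H, p.2⁆ q.2 = -(B p.1 ⁅H, q.1⁆ + B p.2 ⁅H, q.2⁆)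
    rw [hinv, hinv, neg_add]
  · refine Prod.ext ?_ ?_
    · exact leibniz_lie H p.1 q.1
    · change ⁅H, ⁅p.1, q.2⁆ + ⁅p.2, q.1⁆⁆ = (⁅⁅H, p.1⁆, q.2⁆ + ⁅⁅H, p.2⁆, q.1⁆) +
        (⁅p.1, ⁅H, q.2⁆⁆ + ⁅p.2, ⁅H, q.1⁆⁆)
      rw [lie_add, leibniz_lie, leibniz_lie H p.2]
      abel
  · obtain ⟨r, rfl⟩ := hlift p hp
    rw [hJ₀]
    exact Prod.ext (hDι _) (hDι _)
  · obtain ⟨r, rfl⟩ := hlift p hp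
    rw [hJ₀, hJ₀, hJJ, map_neg]
  · obtain ⟨r, rfl⟩ := hlift p hp
    obtain ⟨s, rfl⟩ := hlift q hq
    have := congrArg ι₂ (hJN r s)
    simpa only [nijenhuis, hJ₀, hlie, map_add, map_sub, map_zero] using this

/-- An integrable almost complex structure on a Lie algebra induces one on its tangent Lie
algebra. -/
theorem nijenhuis_prodMap_eq_zero {L : Type*} [LieRing L] [LieAlgebra ℝ L] (J : L →ₗ[ℝ] L)
    (hN : ∀ x y, nijenhuis J x y = 0) (p q : L × L) : nijenhuis (J.prodMap J) p q = 0 := by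
  refine Prod.ext (hN p.1 q.1) ?_
  have h := congrArg₂ (· + ·) (hN p.1 q.2) (hN p.2 q.1)
  simp only [nijenhuis, add_zero] at h
  change J (⁅J p.1, q.2⁆ + ⁅J p.2, q.1⁆) + J (⁅p.1, J q.2⁆ + ⁅p.2, J q.1⁆) +
    (⁅p.1, q.2⁆ + ⁅p.2, q.1⁆) - (⁅J p.1, J q.2⁆ + ⁅J p.2, J q.1⁆) = 0
  rw [← h, map_add, map_add]
  abel

/-- If a finite-dimensional real Lie algebra `𝔤` admits an ad-invariant
positive definite inner product, then for every `k ≥ 1` the iterated tangent Lie algebra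
`T^k𝔤` admits an integrable almost complex structure. -/
theorem iterated_tangent_lie_algebra_admits_complex_structure
    (L : Type u) [LieRing L] [LieAlgebra ℝ L] [FiniteDimensional ℝ L]
    (B : L →ₗ[ℝ] L →ₗ[ℝ] ℝ)
    (hsymm : ∀ X Y : L, B X Y = B Y X)
    (hpos : ∀ X : L, X ≠ 0 → 0 < B X X)
    (hinv : ∀ X Y Z : L, B ⁅X, Y⁆ Z = -B Y ⁅X, Z⁆) :
    ∀ k : ℕ, 1 ≤ k → ∃ J : Tpow L k →ₗ[ℝ] Tpow L k,
      (∀ p : Tpow L k, J (J p) = -p) ∧ (∀ p q : Tpow L k, nijenhuis J p q = 0) := by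
  intro k hk
  induction k, hk using Nat.le_induction with
  | base => exact tangent_exists_complex_structure _ L B rfl hsymm hpos hinv
  | succ k _ ih =>
    obtain ⟨J, hJJ, hN⟩ := ih
    exact ⟨J.prodMap J, fun p => Prod.ext (hJJ _) (hJJ _), nijenhuis_prodMap_eq_zero J hN⟩
end

section
/- (Samelson) Let 𝔤 be a finite-dimensional real Lie algebra of even dimension admitting an ad-invariant positive definite inner product, i.e., an inner product ⟨·,·⟩ with ⟨⁅X,Y⁆, Z⟩ = −⟨Y, ⁅X,Z⁆⟩ for all X, Y, Z ∈ 𝔤 (equivalently, 𝔤 is the Lie algebra of an even-dimensional compact Lie group). Then 𝔤 admits an integrable almost complex structure: a real-linear map J : 𝔤 → 𝔤 with J² = −id and vanishing Nijenhuis tensor. -/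
/-- A positive definite symmetric bilinear form and a skew operator `D` decompose the space into the
kernel of `D` and the eigenspaces of `D ∘ D` for negative eigenvalues. -/
theorem skew_induction {V : Type*} [AddCommGroup V] [Module ℝ V] [FiniteDimensional ℝ V]
    (B : V →ₗ[ℝ] V →ₗ[ℝ] ℝ) (hsymm : ∀ X Y, B X Y = B Y X) (hpos : ∀ X, X ≠ 0 → 0 < B X X)
    (D : V →ₗ[ℝ] V) (hD : ∀ X Y, B (D X) Y = -B X (D Y)) {C : V → Prop}
    (hker : ∀ X, D X = 0 → C X)
    (heig : ∀ c : ℝ, 0 < c → ∀ X, D (D X) = -(c ^ 2 • X) → C X)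
    (hadd : ∀ X Y, C X → C Y → C (X + Y)) (X : V) : C X := by
  have hnonneg : ∀ X, 0 ≤ B X X := fun X => by
    by_cases h : X = 0
    · simp [h]
    · exact (hpos X h).le
  have htop : ⨆ μ, Module.End.eigenspace (-(D ∘ₗ D) : Module.End ℝ V) μ = ⊤ := by
    let core : InnerProductSpace.Core ℝ V :=
      { inner := fun X Y => B X Y
        conj_inner_symm := fun X Y => hsymm Y X
        re_inner_nonneg := fun X => hnonneg X
        add_left := fun X Y Z => by simp
        smul_left := fun X Y r => by simp
        definite := fun X hX => by
          by_contra h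
          exact (hpos X h).ne' hX }
    let : NormedAddCommGroup V := core.toNormedAddCommGroup
    let : InnerProductSpace ℝ V := InnerProductSpace.ofCore core.toCore
    have hS : LinearMap.IsSymmetric (-(D ∘ₗ D) : V →ₗ[ℝ] V) := fun X Y => by
      change B (-(D (D X))) Y = B X (-(D (D Y)))
      simp [hD]
    have := hS.orthogonalComplement_iSup_eigenspaces_eq_bot
    rwa [Submodule.orthogonal_eq_bot_iff] at this
  have hX : X ∈ ⨆ μ, Module.End.eigenspace (-(D ∘ₗ D) : Module.End ℝ V) μ := htop ▸ trivial
  refine Submodule.iSup_induction _ (motive := C) hX (fun μ Y hY => ?_) (hker 0 (map_zero D)) hadd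
  rw [Module.End.mem_eigenspace_iff] at hY
  replace hY : D (D Y) = -(μ • Y) := by
    rw [← hY]; simp
  by_cases hY0 : Y = 0
  · exact hker Y (by simp [hY0])
  have hμ : B (D Y) (D Y) = μ * B Y Y := by
    rw [hD, hY]; simp
  have hpY := hpos Y hY0
  have hμ0 : 0 ≤ μ := by
    by_contra! h
    nlinarith [hnonneg (D Y)]
  rcases hμ0.eq_or_lt with h | h
  · refine hker Y ?_
    by_contra hDY
    exact (hpos _ hDY).ne' (by rw [hμ, ← h, zero_mul])
  · exact heig (√μ) (Real.sqrt_pos.mpr h) Y (by rw [Real.sq_sqrt hμ0, hY])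

/-- There is an operator vanishing on `ker D` and equal to the normalization of `D` on the negative
eigenspaces of `D ∘ D`. -/
theorem exists_polar_part {V : Type*} [AddCommGroup V] [Module ℝ V] [FiniteDimensional ℝ V]
    (D : V →ₗ[ℝ] V) :
    ∃ J : V →ₗ[ℝ] V, (∀ X, D X = 0 → J X = 0) ∧
      ∀ c : ℝ, 0 < c → ∀ X, D (D X) = -(c ^ 2 • X) → J X = c⁻¹ • D X := by
  let S : Module.End ℝ V := -(D ∘ₗ D)
  have hfin : {μ | Module.End.HasEigenvalue S μ}.Finite := Module.End.finite_hasEigenvalue S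
  let p := Lagrange.interpolate hfin.toFinset id fun μ : ℝ => (√μ)⁻¹
  refine ⟨(Polynomial.aeval S p : Module.End ℝ V) ∘ₗ D, fun X hX => by simp [hX],
    fun c hc X hX => ?_⟩
  by_cases h0 : D X = 0
  · simp [h0]
  have hv : Module.End.HasEigenvector S (c ^ 2) (D X) :=
    ⟨Module.End.mem_eigenspace_iff.mpr (by simp [S, hX]), h0⟩
  have hp : p.eval (c ^ 2) = c⁻¹ := by
    have := Lagrange.eval_interpolate_at_node (fun μ : ℝ => (√μ)⁻¹) (s := hfin.toFinset)
      (v := id) Function.injective_id.injOn (i := c ^ 2)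
      (by simpa using Module.End.hasEigenvalue_of_hasEigenvector hv)
    simpa [p, Real.sqrt_sq hc.le] using this
  rw [LinearMap.comp_apply, Module.End.aeval_apply_of_hasEigenvector hv, hp]

theorem even_finrank_of_sq_eq_neg {V : Type*} [AddCommGroup V] [Module ℝ V]
    [FiniteDimensional ℝ V] (J : V →ₗ[ℝ] V) (hJ : ∀ X, J (J X) = -X) :
    Even (Module.finrank ℝ V) := by
  have h : J ∘ₗ J = (-1 : ℝ) • LinearMap.id := by
    ext X; simp [hJ]
  have hdet := congrArg LinearMap.det h
  rw [LinearMap.det_comp, LinearMap.det_smul, LinearMap.det_id, mul_one] at hdet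
  by_contra hodd
  rw [Nat.not_even_iff_odd] at hodd
  rw [hodd.neg_one_pow] at hdet
  nlinarith [mul_self_nonneg (LinearMap.det J)]

theorem exists_sq_eq_neg_of_even_finrank {V : Type*} [AddCommGroup V] [Module ℝ V]
    [FiniteDimensional ℝ V] (h : Even (Module.finrank ℝ V)) :
    ∃ J : V →ₗ[ℝ] V, ∀ X, J (J X) = -X := by
  obtain ⟨k, hk⟩ := h
  let e : V ≃ₗ[ℝ] (Fin k → ℝ) × (Fin k → ℝ) := LinearEquiv.ofFinrankEq _ _ (by simp [hk])
  let R : (Fin k → ℝ) × (Fin k → ℝ) →ₗ[ℝ] (Fin k → ℝ) × (Fin k → ℝ) :=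
    (-LinearMap.snd ℝ _ _).prod (LinearMap.fst ℝ _ _)
  refine ⟨e.symm.toLinearMap ∘ₗ R ∘ₗ e.toLinearMap, fun X => e.injective ?_⟩
  ext <;> simp [R]

theorem nijenhuis_add_left_s13 {L : Type*} [LieRing L] [LieAlgebra ℝ L] (J : L →ₗ[ℝ] L) (X Y Z : L) :
    nijenhuis J (X + Y) Z = nijenhuis J X Z + nijenhuis J Y Z := by
  simp only [nijenhuis, map_add, add_lie]
  abel

theorem nijenhuis_skew {L : Type*} [LieRing L] [LieAlgebra ℝ L] (J : L →ₗ[ℝ] L) (X Y : L) :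
    nijenhuis J Y X = -nijenhuis J X Y := by
  simp only [nijenhuis]
  rw [← lie_skew (J Y) X, ← lie_skew Y (J X), ← lie_skew Y X, ← lie_skew (J Y) (J X)]
  simp only [map_neg]
  abel

theorem nijenhuis_add_right {L : Type*} [LieRing L] [LieAlgebra ℝ L] (J : L →ₗ[ℝ] L)
    (X Y Z : L) : nijenhuis J X (Y + Z) = nijenhuis J X Y + nijenhuis J X Z := by
  simp only [nijenhuis, map_add, lie_add]
  abel

/-- Let `J` agree with the normalization of `ad H` on the negative eigenspaces of `(ad H) ^ 2`.
Then the Nijenhuis tensor of `J` vanishes on pairs of elements of these eigenspaces. -/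
theorem nijenhuis_eq_zero_of_eigen {L : Type*} [LieRing L] [LieAlgebra ℝ L] (J : L →ₗ[ℝ] L)
    (H : L) (hJ : ∀ c : ℝ, 0 < c → ∀ X, ⁅H, ⁅H, X⁆⁆ = -(c ^ 2 • X) → J X = c⁻¹ • ⁅H, X⁆)
    {a b : ℝ} (ha : 0 < a) (hb : 0 < b) {X Y : L} (hX : ⁅H, ⁅H, X⁆⁆ = -(a ^ 2 • X))
    (hY : ⁅H, ⁅H, Y⁆⁆ = -(b ^ 2 • Y)) : nijenhuis J X Y = 0 := by
  have hab : 0 < a + b := add_pos ha hb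
  have lie_J : ∀ c : ℝ, 0 < c → ∀ Z, ⁅H, ⁅H, Z⁆⁆ = -(c ^ 2 • Z) →
      ⁅H, Z⁆ = c • J Z ∧ ⁅H, J Z⁆ = -(c • Z) := fun c hc Z hZ => by
    rw [hJ c hc Z hZ, lie_smul, hZ, smul_smul, mul_inv_cancel₀ hc.ne', one_smul, smul_neg,
      smul_smul]
    refine ⟨rfl, ?_⟩
    congr 2
    field_simp
  obtain ⟨hX1, hX2⟩ := lie_J a ha X hX
  obtain ⟨hY1, hY2⟩ := lie_J b hb Y hY
  have hB : ⁅H, ⁅J X, Y⁆ + ⁅X, J Y⁆⁆ = -((a + b) • (⁅X, Y⁆ - ⁅J X, J Y⁆)) := by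
    simp only [lie_add, leibniz_lie H, hX1, hX2, hY1, hY2, lie_smul, smul_lie, lie_neg, neg_lie]
    module
  have hA : ⁅H, ⁅X, Y⁆ - ⁅J X, J Y⁆⁆ = (a + b) • (⁅J X, Y⁆ + ⁅X, J Y⁆) := by
    simp only [lie_sub, leibniz_lie H, hX1, hX2, hY1, hY2, lie_smul, smul_lie, lie_neg, neg_lie]
    module
  have hJB := hJ (a + b) hab (⁅J X, Y⁆ + ⁅X, J Y⁆) (by
    rw [hB, lie_neg, lie_smul, hA, smul_smul, sq])
  rw [hB, smul_neg, smul_smul, inv_mul_cancel₀ hab.ne', one_smul] at hJB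
  rw [nijenhuis, ← map_add, hJB]
  abel

/-- **Samelson.** An even-dimensional finite-dimensional real Lie algebra
admitting an ad-invariant positive definite inner product (equivalently, the Lie algebra of an
even-dimensional compact Lie group) admits an integrable almost complex structure. -/
theorem samelson_complex_structure
    (L : Type*) [LieRing L] [LieAlgebra ℝ L] [FiniteDimensional ℝ L]
    (heven : Even (Module.finrank ℝ L))
    (B : L →ₗ[ℝ] L →ₗ[ℝ] ℝ)
    (hsymm : ∀ X Y : L, B X Y = B Y X)
    (hpos : ∀ X : L, X ≠ 0 → 0 < B X X)
    (hinv : ∀ X Y Z : L, B ⁅X, Y⁆ Z = -B Y ⁅X, Z⁆) :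
    ∃ J : L →ₗ[ℝ] L, (∀ X : L, J (J X) = -X) ∧ (∀ X Y : L, nijenhuis J X Y = 0) := by
  induction hn : Module.finrank ℝ L using Nat.strong_induction_on generalizing L with
  | _ n ih =>
  by_cases hab : ∀ X Y : L, ⁅X, Y⁆ = 0
  · obtain ⟨J, hJ⟩ := exists_sq_eq_neg_of_even_finrank heven
    exact ⟨J, hJ, fun X Y => by simp [nijenhuis, hab]⟩
  push Not at hab
  obtain ⟨H, Y₀, hHY⟩ := hab
  let D : L →ₗ[ℝ] L := (LieAlgebra.ad ℝ L H : Module.End ℝ L)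
  obtain ⟨K, hK0, hK⟩ := exists_polar_part D
  have span {C : L → Prop} (h0 : ∀ X, ⁅H, X⁆ = 0 → C X)
      (h1 : ∀ c : ℝ, 0 < c → ∀ X, ⁅H, ⁅H, X⁆⁆ = -(c ^ 2 • X) → C X)
      (h2 : ∀ X Y, C X → C Y → C (X + Y)) (X : L) : C X :=
    skew_induction B hsymm hpos D (hinv H) h0 h1 h2 X
  change ∀ X, ⁅H, X⁆ = 0 → K X = 0 at hK0
  change ∀ c : ℝ, 0 < c → ∀ X, ⁅H, ⁅H, X⁆⁆ = -(c ^ 2 • X) → K X = c⁻¹ • ⁅H, X⁆ at hK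
  have hK_eig : ∀ c : ℝ, 0 < c → ∀ X, ⁅H, ⁅H, X⁆⁆ = -(c ^ 2 • X) →
      ⁅H, ⁅H, K X⁆⁆ = -(c ^ 2 • K X) := fun c hc X hX => by
    rw [hK c hc X hX, lie_smul, lie_smul, hX, lie_neg, lie_smul]
    module
  have hKK : ∀ c : ℝ, 0 < c → ∀ X, ⁅H, ⁅H, X⁆⁆ = -(c ^ 2 • X) → K (K X) = -X :=
    fun c hc X hX => by
      rw [hK c hc _ (hK_eig c hc X hX), hK c hc X hX, lie_smul, hX, smul_neg, smul_neg, smul_smul,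
        smul_smul]
      field_simp
      simp
  have hKKK : ∀ X, K (K (K X)) = -K X := span (fun X hX => by simp [hK0 X hX])
    (fun c hc X hX => by simp [hKK c hc X hX]) (fun X Y hX hY => by
      simp only [map_add, hX, hY]; abel)
  let T : LieSubalgebra ℝ L :=
    { LinearMap.ker D with
      lie_mem' := fun {X Y} hX hY => by
        change ⁅H, X⁆ = 0 at hX
        change ⁅H, Y⁆ = 0 at hY
        change ⁅H, ⁅X, Y⁆⁆ = 0
        rw [leibniz_lie, hX, hY]
        simp }
  have mem_T : ∀ X, X ∈ T ↔ ⁅H, X⁆ = 0 := fun X => Iff.rfl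
  let P : L →ₗ[ℝ] L := LinearMap.id + K ∘ₗ K
  have hP0 : ∀ X, ⁅H, X⁆ = 0 → P X = X := fun X hX => by simp [P, hK0 X hX]
  have hP1 : ∀ c : ℝ, 0 < c → ∀ X, ⁅H, ⁅H, X⁆⁆ = -(c ^ 2 • X) → P X = 0 :=
    fun c hc X hX => by simp [P, hKK c hc X hX]
  have hPT : ∀ X, P X ∈ T := span (fun X hX => by rw [hP0 X hX]; exact hX)
    (fun c hc X hX => by rw [hP1 c hc X hX]; exact T.zero_mem)
    (fun X Y hX hY => by rw [map_add]; exact T.add_mem hX hY)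
  have hkerK : LinearMap.ker K = T.toSubmodule := by
    ext X
    refine ⟨fun hX => ?_, hK0 X⟩
    have := hPT X
    rw [LinearMap.mem_ker] at hX
    simpa [P, hX] using this
  have hT_even : Even (Module.finrank ℝ T) := by
    have hr : Even (Module.finrank ℝ (LinearMap.range K)) :=
      even_finrank_of_sq_eq_neg (K.restrict (p := LinearMap.range K) (q := LinearMap.range K)
        fun X _ => ⟨X, rfl⟩) (by
          rintro ⟨_, X, rfl⟩
          exact Subtype.ext (hKKK X))
    have hsum := K.finrank_range_add_finrank_ker
    rw [hkerK] at hsum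
    rw [← hsum, Nat.even_add] at heven
    exact heven.mp hr
  have hT_lt : Module.finrank ℝ T < n := by
    rw [← hn]
    refine Submodule.finrank_lt (s := T.toSubmodule) fun h => hHY ?_
    exact (mem_T Y₀).mp (show Y₀ ∈ T.toSubmodule from h ▸ trivial)
  obtain ⟨J₀, hJ₀, hN₀⟩ := ih _ hT_lt T hT_even
    (B.compl₁₂ T.toSubmodule.subtype T.toSubmodule.subtype)
    (fun X Y => hsymm X Y) (fun X hX => hpos X (by simpa using hX)) (fun X Y Z => hinv X Y Z) rfl
  let J : L →ₗ[ℝ] L := T.toSubmodule.subtype ∘ₗ J₀ ∘ₗ P.codRestrict T.toSubmodule hPT + K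
  have hJT : ∀ X : T, J X = J₀ X := fun X => by
    have : P.codRestrict T.toSubmodule hPT X = X := Subtype.ext (hP0 X X.2)
    simp only [J, LinearMap.add_apply, LinearMap.comp_apply, this, hK0 X X.2, add_zero]
    rfl
  have hJK : ∀ c : ℝ, 0 < c → ∀ X, ⁅H, ⁅H, X⁆⁆ = -(c ^ 2 • X) → J X = K X :=
    fun c hc X hX => by
      have : P.codRestrict T.toSubmodule hPT X = 0 := Subtype.ext (hP1 c hc X hX)
      simp [J, this]
  have hJ1 : ∀ c : ℝ, 0 < c → ∀ X, ⁅H, ⁅H, X⁆⁆ = -(c ^ 2 • X) → J X = c⁻¹ • ⁅H, X⁆ :=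
    fun c hc X hX => (hJK c hc X hX).trans (hK c hc X hX)
  have hJJ : ∀ X, J (J X) = -X := span
    (fun X hX => by
      have h := hJT ⟨X, hX⟩
      rw [show J X = _ from h, hJT, hJ₀]
      rfl)
    (fun c hc X hX => by
      rw [hJK c hc X hX, hJK c hc _ (hK_eig c hc X hX), hKK c hc X hX])
    (fun X Y hX hY => by simp only [map_add, hX, hY]; abel)
  have comm : ∀ X : T, ∀ c : ℝ, 0 < c → ∀ Y, ⁅H, ⁅H, Y⁆⁆ = -(c ^ 2 • Y) →
      J ⁅(X : L), Y⁆ = ⁅(X : L), J Y⁆ := fun X c hc Y hY => by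
    have hX : ∀ Z : L, ⁅H, ⁅(X : L), Z⁆⁆ = ⁅(X : L), ⁅H, Z⁆⁆ := fun Z => by
      rw [leibniz_lie, (mem_T X).mp X.2, zero_lie, zero_add]
    rw [hJ1 c hc Y hY, hJ1 c hc ⁅(X : L), Y⁆ (by rw [hX, hX, hY, lie_neg, lie_smul]), hX, lie_smul]
  have mixed : ∀ X : L, ⁅H, X⁆ = 0 → ∀ c : ℝ, 0 < c → ∀ Y : L, ⁅H, ⁅H, Y⁆⁆ = -(c ^ 2 • Y) →
      nijenhuis J X Y = 0 := fun X hX c hc Y hY => by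
    lift X to T using hX
    rw [nijenhuis, ← comm X c hc Y hY, hJJ, hJT, comm (J₀ X) c hc Y hY]
    abel
  refine ⟨J, hJJ, span (fun X hX => ?_) (fun a ha X hX => ?_) fun X Y hX hY Z => by
    rw [nijenhuis_add_left_s13, hX, hY, add_zero]⟩
  · refine span (fun Y hY => ?_) (mixed X hX) fun Y Z hY hZ => by
      rw [nijenhuis_add_right, hY, hZ, add_zero]
    lift X to T using hX
    lift Y to T using hY
    have := congrArg Subtype.val (hN₀ X Y)
    simpa [nijenhuis, ← LieSubalgebra.coe_bracket, hJT] using this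
  · refine span (fun Y hY => ?_)
      (fun b hb Y hY => nijenhuis_eq_zero_of_eigen J H hJ1 ha hb hX hY) fun Y Z hY hZ => by
        rw [nijenhuis_add_right, hY, hZ, add_zero]
    rw [nijenhuis_skew, mixed Y hY a ha X hX, neg_zero]
end
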